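/- arXiv:2409.20495 — 2 statements merged into one kernel-verified Lean document; each statement's English description precedes it below -/
import Mathlib

section
/- Let G be a nontrivial finite abelian group and let (σ,ρ) be a double partition satisfying σ_r ≤ ρ_s for some positive integers r and s. Then for each nonnegative integer k, (σ +_r k, ρ) ≽_G (σ, ρ +_s k), both being double partitions of n = |σ| + |ρ| + k. -/
/-- The monoid hom `Perm (Fin n) →* MulAut (Fin n → G)`, permuting coordinates. -/
def permMulAut (G : Type*) [CommGroup G] (n : ℕ) :
    Equiv.Perm (Fin n) →* MulAut (Fin n → G) where
  toFun π := MulEquiv.arrowCongr π (MulEquiv.refl G)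
  map_one' := by ext f a; rfl
  map_mul' := by intro π σ; ext f a; rfl

/-- The wreath product `G ≀ Sₙ`. -/
abbrev Wr (G : Type*) [CommGroup G] (n : ℕ) :=
  SemidirectProduct (Fin n → G) (Equiv.Perm (Fin n)) (permMulAut G n)

/-- The natural action of `G ≀ Sₙ` on `G × [n]`. -/
def wAct {G : Type*} [CommGroup G] {n : ℕ} (w : Wr G n) (p : G × Fin n) : G × Fin n :=
  (p.1 * w.left (w.right p.2), w.right p.2)

/-- The `i`-th largest part of a multiset of naturals (0-indexed; `0` beyond the last part). -/
def dparts (s : Multiset ℕ) (i : ℕ) : ℕ := ((s.sort (· ≤ ·)).reverse).getD i 0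

/-- `s` is dominated by `t`. -/
def msDom (s t : Multiset ℕ) : Prop :=
  ∀ k, (((s.sort (· ≤ ·)).reverse).take k).sum ≤ (((t.sort (· ≤ ·)).reverse).take k).sum

/-- `T` is a `(σ,ρ)`-tabloid: the first component assigns to each element of `[n]` a block
(`Sum.inl i` is the block of the `i+1`-st largest part of `σ`, `Sum.inr j` that of `ρ`),
blocks have the prescribed sizes, and the colouring (second component)
is normalised to `1` on the `ρ`-blocks. -/
def IsTabloid (G : Type*) [CommGroup G] (n : ℕ) (σ ρ : Multiset ℕ)
    (T : (Fin n → ℕ ⊕ ℕ) × (Fin n → G)) : Prop :=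
  (∀ i, Nat.card {a : Fin n // T.1 a = Sum.inl i} = dparts σ i) ∧
  (∀ j, Nat.card {a : Fin n // T.1 a = Sum.inr j} = dparts ρ j) ∧
  (∀ a j, T.1 a = Sum.inr j → T.2 a = 1)

/-- The action of the wreath product on (raw) tabloids. -/
def tabAct {G : Type*} [CommGroup G] {n : ℕ} (w : Wr G n)
    (T : (Fin n → ℕ ⊕ ℕ) × (Fin n → G)) : (Fin n → ℕ ⊕ ℕ) × (Fin n → G) :=
  ⟨fun a => T.1 (w.right⁻¹ a),
   fun a => match T.1 (w.right⁻¹ a) with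
     | Sum.inl _ => T.2 (w.right⁻¹ a) * w.left a
     | Sum.inr _ => 1⟩

/-- A subset `Y` of `W` is transitive on `S ⊆ Ω` (w.r.t. an action `act`): there is a
constant `c > 0` such that any `a ∈ S` is mapped to any `b ∈ S` by exactly `c` elements of `Y`. -/
def IsTransitiveOn {W Ω : Type*} (act : W → Ω → Ω) (S : Set Ω) (Y : Set W) : Prop :=
  ∃ c : ℕ, 0 < c ∧ ∀ a ∈ S, ∀ b ∈ S, Nat.card {y : W // y ∈ Y ∧ act y a = b} = c

/-- `Y ⊆ G ≀ Sₙ` is `(σ,ρ)`-transitive. -/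
def DPTransitive (G : Type*) [CommGroup G] (n : ℕ) (σ ρ : Multiset ℕ)
    (Y : Set (Wr G n)) : Prop :=
  IsTransitiveOn tabAct {T | IsTabloid G n σ ρ T} Y

/-- `(σ,ρ) ≽_G (τ,π)` : every `(σ,ρ)`-transitive subset of `G ≀ Sₙ` is `(τ,π)`-transitive. -/
def DPDom (G : Type*) [CommGroup G] (n : ℕ) (σ ρ τ π : Multiset ℕ) : Prop :=
  ∀ Y : Set (Wr G n), DPTransitive G n σ ρ Y → DPTransitive G n τ π Y

/-- The partition obtained by adding `k` to the `r`-th largest part (1-indexed). -/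
def addPart (s : Multiset ℕ) (r k : ℕ) : Multiset ℕ :=
  s.erase (dparts s (r - 1)) + {dparts s (r - 1) + k}


namespace SumRule

/-- Full rank of inclusion matrices of subsets. -/
lemma bool_inj {α : Type*} [DecidableEq α] (k : ℕ) : ∀ (a : ℕ) (X : Finset α) (f : Finset α → ℚ),
    2 * a + k ≤ X.card →
    (∀ E ∈ X.powersetCard (a + k), ∑ D ∈ E.powersetCard a, f D = 0) →
    ∀ D ∈ X.powersetCard a, f D = 0 := by
  intro a
  induction a with
  | zero =>
    intro X f hX h D hD
    simp only [Finset.powersetCard_zero, Finset.mem_singleton] at hD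
    subst hD
    obtain ⟨E, hE⟩ := (Finset.powersetCard_nonempty (n := 0 + k) (s := X)).2 (by omega)
    simpa using h E hE
  | succ a ih =>
    intro X f hX h
    have swap : ∀ x ∈ X, ∀ y ∈ X, x ≠ y → ∀ D ⊆ (X.erase x).erase y, D.card = a →
        f (insert x D) = f (insert y D) := by
      intro x hx y hy hxy D hD hDc
      have := ih ((X.erase x).erase y) (fun D => f (insert x D) - f (insert y D)) ?_ ?_ D
        (by rw [Finset.mem_powersetCard]; exact ⟨hD, hDc⟩)
      · linarith
      · rw [Finset.card_erase_of_mem (by simp [hy, hxy.symm]), Finset.card_erase_of_mem hx]; omega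
      · intro E hE
        rw [Finset.mem_powersetCard] at hE
        obtain ⟨hE1, hE2⟩ := hE
        have key : ∀ z ∈ X, z ∉ E → ∑ D ∈ E.powersetCard (a + 1), f D
            + ∑ D ∈ E.powersetCard a, f (insert z D) = 0 := by
          intro z hz hzE
          rw [← h (insert z E) ?_, Finset.powersetCard_succ_insert hzE, Finset.sum_union,
            Finset.sum_image]
          · intro A hA B hB hAB
            rw [Finset.mem_coe, Finset.mem_powersetCard] at hA hB
            have hA' : z ∉ A := fun hh => hzE (hA.1 hh)
            have hB' : z ∉ B := fun hh => hzE (hB.1 hh)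
            rw [← Finset.erase_insert hA', ← Finset.erase_insert hB', hAB]
          · rw [Finset.disjoint_left]
            intro A hA hA'
            rw [Finset.mem_powersetCard] at hA
            rw [Finset.mem_image] at hA'
            obtain ⟨B, _, rfl⟩ := hA'
            exact hzE (hA.1 (Finset.mem_insert_self _ _))
          · rw [Finset.mem_powersetCard]
            refine ⟨?_, ?_⟩
            · intro w hw
              rw [Finset.mem_insert] at hw
              rcases hw with rfl | hw
              · exact hz
              · have := hE1 hw; simp at this; tauto
            · rw [Finset.card_insert_of_notMem hzE]; omega
        have k1 := key x hx (fun hh => by have := hE1 hh; simp at this)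
        have k2 := key y hy (fun hh => by have := hE1 hh; simp at this)
        rw [Finset.sum_sub_distrib]
        linarith
    have const : ∀ (d : ℕ) (D D' : Finset α), D ∈ X.powersetCard (a + 1) →
        D' ∈ X.powersetCard (a + 1) → (D \ D').card = d → f D = f D' := by
      intro d
      induction d with
      | zero =>
        intro D D' hD hD' hd
        rw [Finset.mem_powersetCard] at hD hD'
        rw [Finset.card_eq_zero, Finset.sdiff_eq_empty_iff_subset] at hd
        rw [Finset.eq_of_subset_of_card_le hd (by omega)]
      | succ d ihd =>
        intro D D' hD hD' hd
        have hDm := hD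
        have hDm' := hD'
        rw [Finset.mem_powersetCard] at hD hD'
        obtain ⟨x, hx⟩ : (D \ D').Nonempty := by rw [← Finset.card_pos]; omega
        obtain ⟨y, hy⟩ : (D' \ D).Nonempty := by
          rw [← Finset.card_pos]
          have := Finset.card_sdiff_add_card_inter D D'
          have := Finset.card_sdiff_add_card_inter D' D
          rw [Finset.inter_comm] at this
          omega
        rw [Finset.mem_sdiff] at hx hy
        have hxy : x ≠ y := by rintro rfl; tauto
        have h1 := swap x (hD.1 hx.1) y (hD'.1 hy.1) hxy (D.erase x) (by
          intro w hw
          rw [Finset.mem_erase] at hw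
          simp only [Finset.mem_erase]
          refine ⟨?_, hw.1, hD.1 hw.2⟩
          rintro rfl; exact hy.2 hw.2) (by rw [Finset.card_erase_of_mem hx.1]; omega)
        rw [Finset.insert_erase hx.1] at h1
        rw [h1]
        have hyn : y ∉ D.erase x := fun hh => hy.2 (Finset.mem_of_mem_erase hh)
        apply ihd _ _ _ hDm'
        · have : (insert y (D.erase x)) \ D' = (D \ D').erase x := by
            ext w
            simp only [Finset.mem_sdiff, Finset.mem_insert, Finset.mem_erase]
            constructor
            · rintro ⟨rfl | h, h'⟩
              · exact absurd hy.1 h'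
              · tauto
            · tauto
          rw [this, Finset.card_erase_of_mem (by simp [hx])]; omega
        · rw [Finset.mem_powersetCard]
          refine ⟨?_, ?_⟩
          · intro w hw
            rw [Finset.mem_insert, Finset.mem_erase] at hw
            rcases hw with rfl | hw
            · exact hD'.1 hy.1
            · exact hD.1 hw.2
          · rw [Finset.card_insert_of_notMem hyn, Finset.card_erase_of_mem hx.1]; omega
    intro D hD
    obtain ⟨E, hE⟩ := (Finset.powersetCard_nonempty (n := a + 1 + k) (s := X)).2 (by omega)
    have h0 := h E hE
    rw [Finset.mem_powersetCard] at hE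
    rw [Finset.sum_congr rfl (fun D' hD' => const _ D' D ?_ hD rfl)] at h0
    · rw [Finset.sum_const, Finset.card_powersetCard, nsmul_eq_mul, mul_eq_zero] at h0
      rcases h0 with h0 | h0
      · have : 0 < E.card.choose (a + 1) := Nat.choose_pos (by omega)
        have h1 : E.card.choose (a + 1) = 0 := by exact_mod_cast h0
        omega
      · exact h0
    · rw [Finset.mem_powersetCard] at hD' ⊢
      exact ⟨hD'.1.trans hE.1, hD'.2⟩

open Classical in
/-- Transfer of transitivity along an equivariant relation with injective incidence map. -/
lemma transfer {W A B : Type*} [Fintype W] [Fintype A] [Fintype B]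
    (actA : W → A ≃ A) (actB : W → B ≃ B) (R : A → B → Prop)
    (hR : ∀ w a b, R (actA w a) (actB w b) ↔ R a b)
    (hinj : ∀ F : A → ℚ, (∀ b, ∑ a with R a b, F a = 0) → ∀ a, F a = 0)
    (Y : Finset W) (c : ℕ) (hc : 0 < c)
    (h : ∀ b b', (Y.filter (fun y => actB y b = b')).card = c) :
    ∃ c' : ℕ, 0 < c' ∧ ∀ a a', (Y.filter (fun y => actA y a = a')).card = c' := by
  rcases isEmpty_or_nonempty A with hA | hA
  · exact ⟨1, one_pos, fun a => (hA.false a).elim⟩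
  obtain ⟨a₀⟩ := hA
  have hB : Nonempty B := by
    by_contra hB
    rw [not_nonempty_iff] at hB
    exact one_ne_zero (hinj (fun _ => 1) (fun b => (hB.false b).elim) a₀)
  obtain ⟨b₀⟩ := hB
  -- number of elements below
  set e : ℕ := (Finset.univ.filter (fun a => R a b₀)).card with he
  have heq : ∀ b, (Finset.univ.filter (fun a => R a b)).card = e := by
    intro b
    have : (Y.filter (fun y => actB y b = b₀)).Nonempty := by
      rw [← Finset.card_pos, h]; exact hc
    obtain ⟨y, hy⟩ := this
    rw [Finset.mem_filter] at hy
    rw [he]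
    apply Finset.card_bij (fun a _ => actA y a)
    · intro a ha
      simp only [Finset.mem_filter, Finset.mem_univ, true_and] at ha ⊢
      rw [← hy.2, hR]; exact ha
    · intro a _ a' _ haa; exact (actA y).injective haa
    · intro a ha
      simp only [Finset.mem_filter, Finset.mem_univ, true_and] at ha
      refine ⟨(actA y).symm a, ?_, by simp⟩
      simp only [Finset.mem_filter, Finset.mem_univ, true_and]
      rw [← hR y, hy.2]; simpa using ha
  have he0 : e ≠ 0 := by
    intro h0
    refine one_ne_zero (hinj (fun _ => 1) (fun b => ?_) a₀)
    simp [heq, h0]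
  have main : ∀ a a', e * (Y.filter (fun y => actA y a = a')).card
      = c * (Finset.univ.filter (fun b => R a b)).card := by
    intro a a'
    have := hinj (fun a' => (e : ℚ) * ((Y.filter (fun y => actA y a = a')).card : ℚ)
      - c * ((Finset.univ.filter (fun b => R a b)).card : ℚ)) ?_ a'
    · have h2 : (e : ℚ) * ((Y.filter (fun y => actA y a = a')).card : ℚ)
        = c * ((Finset.univ.filter (fun b => R a b)).card : ℚ) := by linarith
      exact_mod_cast h2
    · intro b
      have h1 : ∑ a' with R a' b, (Y.filter (fun y => actA y a = a')).card
          = (Y.filter (fun y => R (actA y a) b)).card := by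
        rw [Finset.card_eq_sum_card_fiberwise (f := fun y => actA y a)
          (t := Finset.univ.filter (fun a' => R a' b))]
        · apply Finset.sum_congr rfl
          intro a' ha'
          congr 1
          ext y
          simp only [Finset.mem_filter, Finset.mem_univ, true_and] at ha' ⊢
          constructor
          · rintro ⟨h1, rfl⟩; exact ⟨⟨h1, ha'⟩, rfl⟩
          · rintro ⟨⟨h1, _⟩, h2⟩; exact ⟨h1, h2⟩
        · intro y hy
          simp at hy ⊢
          exact hy.2
      have h2 : (Y.filter (fun y => R (actA y a) b)).card
          = ∑ b' with R a b', (Y.filter (fun y => actB y b' = b)).card := by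
        rw [Finset.card_eq_sum_card_fiberwise (f := fun y => (actB y).symm b)
          (t := Finset.univ.filter (fun b' => R a b'))]
        · apply Finset.sum_congr rfl
          intro b' hb'
          congr 1
          ext y
          simp only [Finset.mem_filter, Finset.mem_univ, true_and, Equiv.symm_apply_eq] at hb' ⊢
          constructor
          · rintro ⟨⟨h1, _⟩, h2⟩; exact ⟨h1, h2.symm⟩
          · rintro ⟨h3, h4⟩; exact ⟨⟨h3, h4 ▸ (hR _ _ _).2 hb'⟩, h4.symm⟩
        · intro y hy
          simp at hy ⊢
          rw [← hR y]; simpa using hy.2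
      rw [Finset.sum_sub_distrib, ← Finset.mul_sum, ← Nat.cast_sum, h1, h2]
      simp only [h, Finset.sum_const, heq, nsmul_eq_mul, smul_eq_mul]
      push_cast
      ring
  have tot : ∀ a a', Fintype.card A * (Y.filter (fun y => actA y a = a')).card = Y.card := by
    intro a a'
    rw [Finset.card_eq_sum_card_fiberwise (s := Y) (f := fun y => actA y a)
          (t := Finset.univ) (fun _ _ => by simp)]
    rw [Finset.sum_congr rfl (fun a'' _ =>
      Nat.eq_of_mul_eq_mul_left (Nat.pos_of_ne_zero he0) ((main a a'').trans (main a a').symm))]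
    simp
  have hA : 0 < Fintype.card A := Fintype.card_pos_iff.2 ⟨a₀⟩
  refine ⟨(Y.filter (fun y => actA y a₀ = a₀)).card, ?_, fun a a' => ?_⟩
  · rw [Nat.pos_iff_ne_zero]
    intro h0
    have h1 := tot a₀ a₀
    rw [h0, mul_zero] at h1
    have h2 := h b₀ b₀
    rw [Finset.card_eq_zero.1 h1.symm] at h2
    simp at h2
    omega
  · exact Nat.eq_of_mul_eq_mul_left hA ((tot a a').trans (tot a₀ a₀).symm)

lemma ncard_getD (l : List ℕ) (v : ℕ) (hv : v ≠ 0) :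
    {i | l.getD i 0 = v}.Finite ∧ {i | l.getD i 0 = v}.ncard = l.count v := by
  induction l with
  | nil => simp [hv.symm]
  | cons x l ih =>
    have : {i | (x :: l).getD i 0 = v}
        = (if x = v then {0} else ∅) ∪ Nat.succ '' {i | l.getD i 0 = v} := by
      ext i
      cases i with
      | zero => split_ifs with h <;> simp [h]
      | succ i => split_ifs with h <;> simp
    have hf : (Nat.succ '' {i | l.getD i 0 = v}).Finite := ih.1.image _
    rw [this]
    split_ifs with h
    · refine ⟨(Set.finite_singleton 0).union hf, ?_⟩
      rw [Set.ncard_union_eq (by simp) (Set.finite_singleton 0) hf,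
        Set.ncard_image_of_injective _ Nat.succ_injective, ih.2]
      simp [h]; omega
    · refine ⟨Set.finite_empty.union hf, ?_⟩
      rw [Set.empty_union, Set.ncard_image_of_injective _ Nat.succ_injective, ih.2]
      simp [h]

lemma ncard_dparts (s : Multiset ℕ) (v : ℕ) (hv : v ≠ 0) :
    {i | dparts s i = v}.Finite ∧ {i | dparts s i = v}.ncard = s.count v := by
  have := ncard_getD ((s.sort (· ≤ ·)).reverse) v hv
  refine ⟨this.1, this.2.trans ?_⟩
  rw [List.count_reverse, ← Multiset.coe_count, Multiset.sort_eq]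

lemma dparts_support (s : Multiset ℕ) : {i | dparts s i ≠ 0}.Finite := by
  apply (Set.finite_lt_nat ((s.sort (· ≤ ·)).reverse).length).subset
  intro i hi
  by_contra h
  simp only [Set.mem_ofPred_eq, not_lt] at h
  exact hi (List.getD_eq_default _ _ h)

lemma dparts_mem (s : Multiset ℕ) (i : ℕ) (h : dparts s i ≠ 0) : dparts s i ∈ s := by
  rw [← Multiset.count_pos, ← (ncard_dparts s _ h).2, Set.ncard_pos (ncard_dparts s _ h).1]
  exact ⟨i, rfl⟩

lemma exists_perm (f g : ℕ → ℕ) (hf : {i | f i ≠ 0}.Finite) (hg : {i | g i ≠ 0}.Finite)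
    (h : ∀ v ≠ 0, {i | f i = v}.ncard = {i | g i = v}.ncard) :
    ∃ e : ℕ ≃ ℕ, ∀ i, g (e i) = f i := by
  have : ∀ v, Nonempty ({i // f i = v} ≃ {i // g i = v}) := by
    intro v
    by_cases hv : v = 0
    · subst hv
      have h1 : Infinite {i // f i = 0} := by
        have h3 := hf.infinite_compl
        have h4 : {i | f i ≠ 0}ᶜ = {i | f i = 0} := by ext i; simp
        rw [h4] at h3
        exact h3.to_subtype
      have h2 : Infinite {i // g i = 0} := by
        have h3 := hg.infinite_compl
        have h4 : {i | g i ≠ 0}ᶜ = {i | g i = 0} := by ext i; simp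
        rw [h4] at h3
        exact h3.to_subtype
      exact nonempty_equiv_of_countable
    · have h1 : Finite {i // f i = v} := hf.subset (fun i (hi : f i = v) => by simp [hi, hv])
      have h2 : Finite {i // g i = v} := hg.subset (fun i (hi : g i = v) => by simp [hi, hv])
      exact Finite.card_eq.1 (h v hv)
  exact ⟨Equiv.ofFiberEquiv (fun v => (this v).some), fun i => Equiv.ofFiberEquiv_map _ _⟩

lemma addPart_perm (s : Multiset ℕ) (j k : ℕ) (h0 : 0 ∉ s) :
    ∃ e : ℕ ≃ ℕ, ∀ i, dparts (addPart s (j + 1) k) (e i)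
      = Function.update (dparts s) j (dparts s j + k) i := by
  have hsub : ∀ v ≠ 0, {i | Function.update (dparts s) j (dparts s j + k) i = v}
        = ({i | dparts s i = v} \ {j}) ∪ (if dparts s j + k = v then {j} else ∅) := by
    intro v hv
    ext i
    by_cases hi : i = j
    · subst hi; split_ifs with h <;> simp [h]
    · split_ifs with h <;> simp [hi]
  apply exists_perm
  · apply ((dparts_support s).union (Set.finite_singleton j)).subset
    intro i hi
    by_cases hij : i = j
    · right; exact hij
    · left; simpa [hij] using hi
  · exact dparts_support _
  · intro v hv
    obtain ⟨hfin, hcard⟩ := ncard_dparts s v hv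
    rw [(ncard_dparts _ v hv).2, hsub v hv, addPart, Multiset.count_add, Multiset.count_singleton,
      Nat.add_sub_cancel]
    have hA : ({i | dparts s i = v} \ {j}).ncard = (s.erase (dparts s j)).count v := by
      by_cases hj : dparts s j = v
      · rw [Set.ncard_sdiff_singleton_of_mem (by exact hj), hcard, hj, Multiset.count_erase_self]
      · rw [Set.sdiff_singleton_eq_self (by exact hj), hcard,
          Multiset.count_erase_of_ne (fun h => hj h.symm)]
    by_cases h : dparts s j + k = v
    · rw [if_pos h, if_pos h.symm, Set.ncard_union_eq (by simp) (hfin.sdiff) (Set.finite_singleton j),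
        hA, Set.ncard_singleton]
    · rw [if_neg h, if_neg (fun hh => h hh.symm), Set.union_empty, hA, add_zero]

end SumRule

namespace SumRule

/-- Raw tabloids. -/
abbrev Tab (G : Type) (n : ℕ) := (Fin n → ℕ ⊕ ℕ) × (Fin n → G)

lemma isTab_iff {G : Type} [CommGroup G] {n : ℕ} {σ ρ : Multiset ℕ} {T : Tab G n} :
    IsTabloid G n σ ρ T ↔
    (∀ i, (Finset.univ.filter (fun x => T.1 x = Sum.inl i)).card = dparts σ i) ∧
    (∀ j, (Finset.univ.filter (fun x => T.1 x = Sum.inr j)).card = dparts ρ j) ∧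
    (∀ a j, T.1 a = Sum.inr j → T.2 a = 1) := by
  simp only [IsTabloid, Nat.card_eq_fintype_card, Fintype.card_subtype]

lemma finite_tab (G : Type) [CommGroup G] [Fintype G] (n : ℕ) (σ ρ : Multiset ℕ) :
    {T : Tab G n | IsTabloid G n σ ρ T}.Finite := by
  have h1 : (Sum.inl '' {i | dparts σ i ≠ 0} ∪ Sum.inr '' {i | dparts ρ i ≠ 0} :
      Set (ℕ ⊕ ℕ)).Finite :=
    ((dparts_support σ).image _).union ((dparts_support ρ).image _)
  have h2 := (Set.Finite.pi' (fun _ : Fin n => h1)).prod (Set.finite_univ (α := Fin n → G))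
  apply h2.subset
  intro T hT
  obtain ⟨hl, hr, _⟩ := isTab_iff.1 hT
  refine ⟨fun x => ?_, trivial⟩
  rcases h : T.1 x with i | i
  · left
    refine ⟨i, ?_, rfl⟩
    rw [Set.mem_ofPred_eq, ← hl i, ← Nat.pos_iff_ne_zero, Finset.card_pos]
    exact ⟨x, by simp [h]⟩
  · right
    refine ⟨i, ?_, rfl⟩
    rw [Set.mem_ofPred_eq, ← hr i, ← Nat.pos_iff_ne_zero, Finset.card_pos]
    exact ⟨x, by simp [h]⟩

lemma act_mem {G : Type} [CommGroup G] {n : ℕ} {σ ρ : Multiset ℕ} (w : Wr G n) {T : Tab G n}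
    (hT : IsTabloid G n σ ρ T) : IsTabloid G n σ ρ (tabAct w T) := by
  obtain ⟨hl, hr, h1⟩ := hT
  refine ⟨fun i => ?_, fun i => ?_, fun x j hx => ?_⟩
  · rw [← hl i]
    exact Nat.card_congr (Equiv.subtypeEquiv (w.right⁻¹) (fun a => Iff.rfl))
  · rw [← hr i]
    exact Nat.card_congr (Equiv.subtypeEquiv (w.right⁻¹) (fun a => Iff.rfl))
  · have hx' : T.1 (w.right⁻¹ x) = Sum.inr j := hx
    simp only [tabAct, hx']

lemma act_inj {G : Type} [CommGroup G] {n : ℕ} {σ ρ : Multiset ℕ} (w : Wr G n) {T T' : Tab G n}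
    (hT : IsTabloid G n σ ρ T) (hT' : IsTabloid G n σ ρ T') (h : tabAct w T = tabAct w T') :
    T = T' := by
  have h1 : ∀ x, T.1 x = T'.1 x := by
    intro x
    have := congrFun (congrArg Prod.fst h) (w.right x)
    simpa [tabAct] using this
  have h2 : ∀ x, T.2 x = T'.2 x := by
    intro x
    have h3 := congrFun (congrArg Prod.snd h) (w.right x)
    have h4 := h1 x
    rcases h5 : T.1 x with i | i
    · rw [h5] at h4
      simpa [tabAct, h5, ← h4] using h3
    · rw [h5] at h4
      rw [hT.2.2 x i h5, hT'.2.2 x i h4.symm]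
  exact Prod.ext (funext h1) (funext h2)

/-- The action of an element of the wreath product as a permutation of the tabloids. -/
noncomputable def actEquiv {G : Type} [CommGroup G] [Fintype G] {n : ℕ} (σ ρ : Multiset ℕ)
    (w : Wr G n) : {T : Tab G n // IsTabloid G n σ ρ T} ≃ {T : Tab G n // IsTabloid G n σ ρ T} :=
  haveI : Finite {T : Tab G n // IsTabloid G n σ ρ T} := finite_tab G n σ ρ
  Equiv.ofBijective (fun T => ⟨tabAct w T.1, act_mem w T.2⟩)
    (Finite.injective_iff_bijective.1 (fun T T' h =>
      Subtype.ext (act_inj w T.2 T'.2 (congrArg Subtype.val h))))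

/-- The incidence relation. -/
def Rel {G : Type} {n : ℕ} (e f : ℕ ≃ ℕ) (r s : ℕ) (g h : Tab G n) : Prop :=
  ∀ x, (h.1 x = Sum.map e f (g.1 x) ∧ ((g.1 x).isLeft → g.2 x = h.2 x)) ∨
    (g.1 x = Sum.inr s ∧ h.1 x = Sum.inl (e r))

lemma rel_act {G : Type} [CommGroup G] {n : ℕ} (e f : ℕ ≃ ℕ) (r s : ℕ) (w : Wr G n)
    (g h : Tab G n) : Rel e f r s (tabAct w g) (tabAct w h) ↔ Rel e f r s g h := by
  unfold Rel
  rw [← w.right.forall_congr_right]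
  apply forall_congr'
  intro x
  apply or_congr
  · have hwx : w.right⁻¹ (w.right x) = x := by simp
    simp only [tabAct, hwx]
    apply and_congr_right
    intro hx
    rcases hg : g.1 x with i | i
    · rw [hg] at hx
      simp [hx]
    · simp
  · simp [tabAct]

/-- Replacing the blocks on `X`: `D` gets label `u`, `X \ D` gets label `v`. -/
def mk {G : Type} [CommGroup G] {n : ℕ} (T : Tab G n) (t : ℕ ⊕ ℕ → ℕ ⊕ ℕ) (u v : ℕ ⊕ ℕ)
    (X D : Finset (Fin n)) : Tab G n :=
  (fun x => if x ∈ D then u else if x ∈ X then v else t (T.1 x),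
   fun x => if x ∈ D ∨ x ∉ X then T.2 x else 1)

lemma mk_isTab {G : Type} [CommGroup G] {n : ℕ} {σ π p q : Multiset ℕ} (T : Tab G n)
    (hT : IsTabloid G n σ π T) (e f : ℕ ≃ ℕ) (r s : ℕ) (X D : Finset (Fin n))
    (hX : ∀ x, x ∈ X ↔ T.1 x = Sum.inl r ∨ T.1 x = Sum.inr s) (hD : D ⊆ X)
    (hp : dparts p (e r) = D.card) (hp' : ∀ i, i ≠ r → dparts p (e i) = dparts σ i)
    (hq : dparts q (f s) = X.card - D.card) (hq' : ∀ i, i ≠ s → dparts q (f i) = dparts π i) :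
    IsTabloid G n p q (mk T (Sum.map e f) (Sum.inl (e r)) (Sum.inr (f s)) X D) := by
  rw [isTab_iff] at hT ⊢
  obtain ⟨hl, hr, h1⟩ := hT
  refine ⟨fun i => ?_, fun i => ?_, fun x j hx => ?_⟩
  · obtain ⟨i, rfl⟩ := e.surjective i
    by_cases hi : i = r
    · subst hi
      rw [hp]
      congr 1
      ext x
      have h2 := hX x
      have h3 := @hD x
      have he : ∀ a b, e a = e b → a = b := fun a b h => e.injective h
      have hf : ∀ a b, f a = f b → a = b := fun a b h => f.injective h
      simp only [mk, Finset.mem_filter, Finset.mem_univ, true_and, Finset.mem_sdiff]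
      clear hl hr hp hp' hq hq' hX hD h1
      rcases hg : T.1 x with j | j <;> grind
    · rw [hp' i hi, ← hl i]
      congr 1
      ext x
      have h2 := hX x
      have h3 := @hD x
      have he : ∀ a b, e a = e b → a = b := fun a b h => e.injective h
      have hf : ∀ a b, f a = f b → a = b := fun a b h => f.injective h
      simp only [mk, Finset.mem_filter, Finset.mem_univ, true_and, Finset.mem_sdiff]
      clear hl hr hp hp' hq hq' hX hD h1
      rcases hg : T.1 x with j | j <;> grind
  · obtain ⟨i, rfl⟩ := f.surjective i
    by_cases hi : i = s
    · subst hi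
      rw [hq, ← Finset.card_sdiff_of_subset hD]
      congr 1
      ext x
      have h2 := hX x
      have h3 := @hD x
      have he : ∀ a b, e a = e b → a = b := fun a b h => e.injective h
      have hf : ∀ a b, f a = f b → a = b := fun a b h => f.injective h
      simp only [mk, Finset.mem_filter, Finset.mem_univ, true_and, Finset.mem_sdiff]
      clear hl hr hp hp' hq hq' hX hD h1
      rcases hg : T.1 x with j | j <;> grind
    · rw [hq' i hi, ← hr i]
      congr 1
      ext x
      have h2 := hX x
      have h3 := @hD x
      have he : ∀ a b, e a = e b → a = b := fun a b h => e.injective h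
      have hf : ∀ a b, f a = f b → a = b := fun a b h => f.injective h
      simp only [mk, Finset.mem_filter, Finset.mem_univ, true_and, Finset.mem_sdiff]
      clear hl hr hp hp' hq hq' hX hD h1
      rcases hg : T.1 x with j | j <;> grind
  · have h2 := hX x
    have h3 := h1 x
    have h4 := @hD x
    simp only [mk] at hx ⊢
    clear hl hr hp hp' hq hq' hX hD h1
    rcases hg : T.1 x with j | j <;> grind

lemma rel_mk {G : Type} [CommGroup G] {n : ℕ} {σ π : Multiset ℕ} (T : Tab G n)
    (hT : IsTabloid G n σ π T) (e f : ℕ ≃ ℕ) (r s : ℕ) (X E : Finset (Fin n))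
    (hX : ∀ x, x ∈ X ↔ T.1 x = Sum.inl r ∨ T.1 x = Sum.inr s) (hE : E ⊆ X)
    (g : Tab G n) (hg : IsTabloid G n σ π g) :
    Rel e f r s g (mk T (Sum.map e f) (Sum.inl (e r)) (Sum.inr (f s)) X E) ↔
    ∃ D ∈ E.powersetCard (dparts σ r), mk T id (Sum.inl r) (Sum.inr s) X D = g := by
  constructor
  · intro h
    refine ⟨Finset.univ.filter (fun x => g.1 x = Sum.inl r), ?_, ?_⟩
    · rw [Finset.mem_powersetCard]
      refine ⟨?_, (isTab_iff.1 hg).1 r⟩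
      intro x hx
      have h1 := h x
      have h2 := hX x
      rw [Finset.mem_filter] at hx
      rw [hx.2] at h1
      have he : ∀ a b, e a = e b → a = b := fun a b h => e.injective h
      simp only [mk] at h1
      clear hX hE hg hT h
      rcases ht : T.1 x with j | j <;> grind
    · have key : ∀ x, (mk T id (Sum.inl r) (Sum.inr s) X
          (Finset.univ.filter (fun x => g.1 x = Sum.inl r))).1 x = g.1 x ∧
          (mk T id (Sum.inl r) (Sum.inr s) X
          (Finset.univ.filter (fun x => g.1 x = Sum.inl r))).2 x = g.2 x := by
        intro x
        have h1 := h x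
        have h2 := hX x
        have h3 := hg.2.2 x
        have h4 := hT.2.2 x
        have h5 := @hE x
        have he : ∀ a b, e a = e b → a = b := fun a b h => e.injective h
        have hf : ∀ a b, f a = f b → a = b := fun a b h => f.injective h
        simp only [mk, Finset.mem_filter, Finset.mem_univ, true_and, id] at h1 ⊢
        clear hX hE hg hT h
        rcases ht : T.1 x with j | j <;> rcases hgx : g.1 x with j' | j' <;>
          simp only [ht, hgx] at h1 h2 h3 h4 ⊢ <;> clear ht hgx <;> grind
      exact Prod.ext (funext fun x => (key x).1) (funext fun x => (key x).2)
  · rintro ⟨D, hD, rfl⟩ x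
    rw [Finset.mem_powersetCard] at hD
    have h2 := hX x
    have h5 := @hE x
    have h6 := @hD.1 x
    simp only [mk, id]
    clear hX hE hg hT hD
    rcases ht : T.1 x with j | j <;> grind

lemma mk_inj {G : Type} [CommGroup G] {n : ℕ} (T : Tab G n)
    (r s : ℕ) (X D D' : Finset (Fin n))
    (hD : D ⊆ X) (hD' : D' ⊆ X)
    (h : mk T id (Sum.inl r) (Sum.inr s) X D = mk T id (Sum.inl r) (Sum.inr s) X D') :
    D = D' := by
  ext x
  have h1 := congrFun (congrArg Prod.fst h) x
  have := @hD x
  have := @hD' x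
  simp only [mk] at h1
  grind

lemma mk_self {G : Type} [CommGroup G] {n : ℕ} {σ π : Multiset ℕ} (T : Tab G n)
    (hT : IsTabloid G n σ π T) (r s : ℕ) (X A : Finset (Fin n))
    (hX : ∀ x, x ∈ X ↔ T.1 x = Sum.inl r ∨ T.1 x = Sum.inr s)
    (hA : ∀ x, x ∈ A ↔ T.1 x = Sum.inl r) :
    mk T id (Sum.inl r) (Sum.inr s) X A = T := by
  refine Prod.ext (funext fun x => ?_) (funext fun x => ?_)
  · have := hX x
    have := hA x
    simp only [mk]
    grind
  · have := hX x
    have := hA x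
    have := hT.2.2 x
    simp only [mk]
    grind

end SumRule

namespace SumRule

lemma card_conv {W : Type*} [Fintype W] (Y : Set W) (P : W → Prop) (Q : W → Prop)
    {_ : DecidablePred Q} {_ : DecidablePred (· ∈ Y)} (h : ∀ y, P y ↔ Q y) :
    Nat.card {y : W // y ∈ Y ∧ P y}
      = ((Finset.univ.filter (· ∈ Y)).filter Q).card := by
  rw [Finset.filter_filter, ← Fintype.card_subtype, ← Nat.card_eq_fintype_card]
  exact Nat.card_congr (Equiv.subtypeEquivRight (fun y => by rw [h y]))

open Classical in
lemma main (G : Type) [CommGroup G] [Fintype G] (n : ℕ)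
    (σ ρ : Multiset ℕ) (hσ0 : 0 ∉ σ) (hρ0 : 0 ∉ ρ) (r s : ℕ)
    (hle : dparts σ r ≤ dparts ρ s) (k : ℕ) :
    DPDom G n (addPart σ (r + 1) k) ρ σ (addPart ρ (s + 1) k) := by
  intro Y hY
  obtain ⟨c, hc, hY⟩ := hY
  have : Finite (Wr G n) := Finite.of_equiv _ SemidirectProduct.equivProd.symm
  let : Fintype (Wr G n) := Fintype.ofFinite _
  obtain ⟨e, he⟩ := addPart_perm σ r k hσ0
  obtain ⟨e2, he2⟩ := addPart_perm ρ s k hρ0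
  set p := addPart σ (r + 1) k with hp
  set π := addPart ρ (s + 1) k with hπ
  have : Finite {T : Tab G n // IsTabloid G n σ π T} := finite_tab G n σ π
  have : Finite {T : Tab G n // IsTabloid G n p ρ T} := finite_tab G n p ρ
  let : Fintype {T : Tab G n // IsTabloid G n σ π T} := Fintype.ofFinite _
  let : Fintype {T : Tab G n // IsTabloid G n p ρ T} := Fintype.ofFinite _
  have hinj : ∀ F : {T : Tab G n // IsTabloid G n σ π T} → ℚ,
      (∀ b : {T : Tab G n // IsTabloid G n p ρ T},
        ∑ a with Rel e e2.symm r (e2 s) a.1 b.1, F a = 0) → ∀ a, F a = 0 := by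
    rintro F hF ⟨T, hT⟩
    set A := Finset.univ.filter (fun x => T.1 x = Sum.inl r) with hA
    set C := Finset.univ.filter (fun x => T.1 x = Sum.inr (e2 s)) with hC
    set X := A ∪ C with hXdef
    have hX : ∀ x, x ∈ X ↔ T.1 x = Sum.inl r ∨ T.1 x = Sum.inr (e2 s) := by
      intro x; simp [hXdef, hA, hC]
    have hAc : A.card = dparts σ r := (isTab_iff.1 hT).1 r
    have hCc : C.card = dparts ρ s + k := by
      rw [hC, (isTab_iff.1 hT).2.1 (e2 s), he2]; simp
    have hXc : X.card = dparts σ r + (dparts ρ s + k) := by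
      rw [← hAc, ← hCc, hXdef]
      apply Finset.card_union_of_disjoint
      rw [Finset.disjoint_left]
      intro x h1 h2
      simp only [hA, hC, Finset.mem_filter, Finset.mem_univ, true_and] at h1 h2
      rw [h1] at h2
      cases h2
    -- the two families
    have hg : ∀ D ∈ X.powersetCard (dparts σ r),
        IsTabloid G n σ π (mk T id (Sum.inl r) (Sum.inr (e2 s)) X D) := by
      intro D hD
      rw [Finset.mem_powersetCard] at hD
      have := mk_isTab (p := σ) (q := π) T hT (Equiv.refl ℕ) (Equiv.refl ℕ) r (e2 s) X D hX hD.1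
        hD.2.symm (fun _ _ => rfl) (by
          rw [Equiv.refl_apply, he2, hXc, hD.2]; simp) (fun _ _ => rfl)
      simpa using this
    have hh : ∀ E ∈ X.powersetCard (dparts σ r + k),
        IsTabloid G n p ρ (mk T (Sum.map e e2.symm) (Sum.inl (e r))
          (Sum.inr (e2.symm (e2 s))) X E) := by
      intro E hE
      rw [Finset.mem_powersetCard] at hE
      apply mk_isTab T hT e e2.symm r (e2 s) X E hX hE.1
      · rw [he, hE.2]; simp
      · intro i hi; rw [he]; simp [hi]
      · rw [hXc, hE.2, Equiv.symm_apply_apply]; omega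
      · intro i hi
        obtain ⟨i, rfl⟩ := e2.surjective i
        have hi' : i ≠ s := fun h => hi (by rw [h])
        rw [he2, Equiv.symm_apply_apply]; simp [hi']
    have hb := bool_inj k (dparts σ r) X
      (fun D => if hD : IsTabloid G n σ π (mk T id (Sum.inl r) (Sum.inr (e2 s)) X D) then
        F ⟨_, hD⟩ else 0) (by omega) ?_ A ?_
    · have hs := mk_self T hT r (e2 s) X A hX (by simp [hA])
      simp only [hs] at hb
      rwa [dif_pos hT] at hb
    · intro E hE
      have hE' := Finset.mem_powersetCard.1 hE
      rw [← hF ⟨_, hh E hE⟩]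
      have hsub : ∀ D ∈ E.powersetCard (dparts σ r), D ∈ X.powersetCard (dparts σ r) := by
        intro D hD
        rw [Finset.mem_powersetCard] at hD ⊢
        exact ⟨hD.1.trans hE'.1, hD.2⟩
      refine Finset.sum_bij (fun D hD => ⟨_, hg D (hsub D hD)⟩) ?_ ?_ ?_ ?_
      · intro D hD
        rw [Finset.mem_filter]
        exact ⟨Finset.mem_univ _, (rel_mk T hT e e2.symm r (e2 s) X E hX hE'.1 _
          (hg D (hsub D hD))).2 ⟨D, hD, rfl⟩⟩
      · intro D hD D' hD' h
        exact mk_inj T r (e2 s) X D D' (Finset.mem_powersetCard.1 (hsub D hD)).1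
          (Finset.mem_powersetCard.1 (hsub D' hD')).1 (congrArg Subtype.val h)
      · rintro ⟨g, hgt⟩ hgR
        rw [Finset.mem_filter] at hgR
        obtain ⟨D, hD, hDg⟩ := (rel_mk T hT e e2.symm r (e2 s) X E hX hE'.1 g hgt).1 hgR.2
        exact ⟨D, hD, Subtype.ext hDg⟩
      · intro D hD
        rw [dif_pos (hg D (hsub D hD))]
    · rw [Finset.mem_powersetCard]
      exact ⟨Finset.subset_union_left, hAc⟩
  obtain ⟨c', hc', h'⟩ := transfer (actEquiv σ π) (actEquiv p ρ)
    (fun a b => Rel e e2.symm r (e2 s) a.1 b.1)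
    (fun w a b => rel_act e e2.symm r (e2 s) w a.1 b.1) hinj
    (Finset.univ.filter (· ∈ Y)) c hc (fun b b' => by
      rw [← hY b.1 b.2 b'.1 b'.2]
      exact (card_conv Y _ _ (fun y => ⟨fun h => Subtype.ext h, fun h => congrArg Subtype.val h⟩)).symm)
  refine ⟨c', hc', fun a ha b hb => ?_⟩
  rw [← h' ⟨a, ha⟩ ⟨b, hb⟩]
  exact card_conv Y _ _ (fun y => ⟨fun h => Subtype.ext h, fun h => congrArg Subtype.val h⟩)

end SumRule

/-- **Sum rule.**
Let `G` be a nontrivial finite abelian group and `(σ,ρ)` a double partition with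
`σ_r ≤ ρ_s` for some positive integers `r`, `s`.  Then for each nonnegative integer `k`,
`(σ +_r k, ρ) ≽_G (σ, ρ +_s k)`, both being double partitions of `n = |σ| + |ρ| + k`.
(Here `λ +_r k` adds `k` to the `r`-th part of `λ` and reorders decreasingly, and
`λ_r` denotes the `r`-th largest part, `0` if `r` exceeds the number of parts.) -/
theorem sum_rule (G : Type) [CommGroup G] [Fintype G] [Nontrivial G]
    (σ ρ : Multiset ℕ) (hσ0 : 0 ∉ σ) (hρ0 : 0 ∉ ρ)
    (r s : ℕ) (hr : 1 ≤ r) (hs : 1 ≤ s)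
    (hle : dparts σ (r - 1) ≤ dparts ρ (s - 1)) (k : ℕ) :
    DPDom G (σ.sum + ρ.sum + k) (addPart σ r k) ρ σ (addPart ρ s k) := by
  obtain ⟨r, rfl⟩ : ∃ r', r = r' + 1 := ⟨r - 1, by omega⟩
  obtain ⟨s, rfl⟩ : ∃ s', s = s' + 1 := ⟨s - 1, by omega⟩
  exact SumRule.main G _ σ ρ hσ0 hρ0 r s hle k
end

section
/- Let G be a nontrivial finite abelian group, let (σ,ρ) be a double partition of n, and let i, j be positive integers with σ_i > ρ_j. Let (σ̃, ρ̃) be the double partition of n obtained from (σ,ρ) by exchanging the part σ_i of σ with the part ρ_j of ρ (that is, σ̃ is σ with the part σ_i replaced by ρ_j, ρ̃ is ρ with the part ρ_j replaced by σ_i, each reordered decreasingly). Then (σ,ρ) ≽_G (σ̃,ρ̃). -/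
section PartialFunctions
open Finset
open scoped Classical

variable {α G : Type} [Fintype α] [Fintype G]

/-- The support of a partial function. -/
noncomputable def pS (p : α → Option G) : Finset α := univ.filter (fun x => p x ≠ none)

/-- Extension order on partial functions. -/
def ple (p q : α → Option G) : Prop := ∀ x, p x = none ∨ p x = q x

/-- Partial functions of rank `b` below `q`. -/
noncomputable def low (b : ℕ) (q : α → Option G) : Finset (α → Option G) :=
  univ.filter (fun p => ple p q ∧ (pS p).card = b)

theorem mem_pS (p : α → Option G) (x : α) : x ∈ pS p ↔ p x ≠ none := by simp [pS]

theorem mem_low (b : ℕ) (p q : α → Option G) :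
    p ∈ low b q ↔ ple p q ∧ (pS p).card = b := by simp [low]

theorem ple_pS {p q : α → Option G} (h : ple p q) : pS p ⊆ pS q := by
  intro x hx
  rw [mem_pS] at *
  rcases h x with h | h
  · exact absurd h hx
  · rwa [← h]

theorem pS_update_none (q : α → Option G) (x : α) :
    pS (Function.update q x none) = (pS q).erase x := by
  ext y
  by_cases h : y = x
  · subst h; simp [mem_pS]
  · simp [mem_pS, h]

theorem pS_update_some (q : α → Option G) (x : α) (g : G) :
    pS (Function.update q x (some g)) = insert x (pS q) := by
  ext y
  by_cases h : y = x
  · subst h; simp [mem_pS]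
  · simp [mem_pS, h]

theorem ple_update_none (p q : α → Option G) (x : α) :
    ple p (Function.update q x none) ↔ ple p q ∧ p x = none := by
  constructor
  · intro h
    have hx : p x = none := by
      rcases h x with h | h
      · exact h
      · simpa using h
    refine ⟨fun y => ?_, hx⟩
    by_cases hy : y = x
    · subst hy; exact Or.inl hx
    · have := h y
      rwa [Function.update_of_ne hy] at this
  · rintro ⟨h, hx⟩ y
    by_cases hy : y = x
    · subst hy; exact Or.inl hx
    · rw [Function.update_of_ne hy]; exact h y

theorem step_erase (b : ℕ) (q : α → Option G) (φ : (α → Option G) → ℚ) :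
    ∑ x ∈ pS q, ∑ p ∈ low b (Function.update q x none), φ p
      = ((pS q).card - b : ℚ) * ∑ p ∈ low b q, φ p := by
  have h1 : ∀ x, low b (Function.update q x none) = (low b q).filter (fun p => p x = none) := by
    intro x
    ext p
    simp only [mem_low, mem_filter, ple_update_none]
    tauto
  simp_rw [h1, sum_filter]
  rw [sum_comm, mul_sum]
  refine sum_congr rfl fun p hp => ?_
  rw [mem_low] at hp
  rw [← sum_filter, sum_const, nsmul_eq_mul]
  congr 1
  have h2 : (pS q).filter (fun x => p x = none) = pS q \ pS p := by
    ext x; simp [mem_pS]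
  rw [h2, card_sdiff_of_subset (ple_pS hp.1), Nat.cast_sub (card_le_card (ple_pS hp.1)), hp.2]

theorem step_add (b : ℕ) (q : α → Option G) (x : α) (hx : q x = none) (g : G)
    (φ : (α → Option G) → ℚ) :
    ∑ p ∈ low (b + 1) (Function.update q x (some g)), φ p
      = ∑ p ∈ low (b + 1) q, φ p + ∑ p ∈ low b q, φ (Function.update p x (some g)) := by
  rw [← sum_filter_add_sum_filter_not _ (fun p => p x = none)]
  congr 1
  · refine sum_congr ?_ fun _ _ => rfl
    have : q = Function.update (Function.update q x (some g)) x none := by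
      simp [← hx]
    ext p
    conv_rhs => rw [this]
    simp only [mem_low, mem_filter, ple_update_none]
    tauto
  · have key : ∀ p, ple p (Function.update q x (some g)) → p x ≠ none → p x = some g := by
      intro p h h'
      rcases h x with h | h
      · exact absurd h h'
      · simpa using h
    refine sum_nbij' (fun p => Function.update p x none)
      (fun p => Function.update p x (some g)) ?_ ?_ ?_ ?_ ?_
    · intro p hp
      simp only [mem_filter, mem_low] at hp
      obtain ⟨⟨h1, h2⟩, h3⟩ := hp
      rw [mem_low, pS_update_none, card_erase_of_mem ((mem_pS _ _).2 h3), h2]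
      refine ⟨fun y => ?_, rfl⟩
      by_cases hy : y = x
      · subst hy; simp
      · have := h1 y
        rw [Function.update_of_ne hy] at this
        rwa [Function.update_of_ne hy]
    · intro p hp
      rw [mem_low] at hp
      have hpx : p x = none := by
        rcases hp.1 x with h | h
        · exact h
        · rw [h, hx]
      simp only [mem_filter, mem_low]
      rw [pS_update_some, card_insert_of_notMem (by simp [mem_pS, hpx]), hp.2]
      refine ⟨⟨fun y => ?_, rfl⟩, by simp⟩
      by_cases hy : y = x
      · subst hy; simp
      · rw [Function.update_of_ne hy, Function.update_of_ne hy]; exact hp.1 y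
    · intro p hp
      simp only [mem_filter, mem_low] at hp
      simp [← key p hp.1.1 hp.2]
    · intro p hp
      rw [mem_low] at hp
      have hpx : p x = none := by
        rcases hp.1 x with h | h
        · exact h
        · rw [h, hx]
      simp [← hpx]
    · intro p hp
      simp only [mem_filter, mem_low] at hp
      simp [← key p hp.1.1 hp.2]

/-- There is a partial function with prescribed support. -/
theorem exists_pS [Nonempty G] (A : Finset α) : ∃ q : α → Option G, pS q = A := by
  obtain ⟨g⟩ := ‹Nonempty G›
  refine ⟨fun x => if x ∈ A then some g else none, ?_⟩
  ext x
  simp [mem_pS]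

theorem low_inj [Nonempty G] (N : Finset α) : ∀ (a b : ℕ) (φ : (α → Option G) → ℚ), b ≤ a →
    a + b ≤ N.card →
    (∀ q, pS q ⊆ N → (pS q).card = a → ∑ p ∈ low b q, φ p = 0) →
    ∀ p, pS p ⊆ N → (pS p).card = b → φ p = 0 := by
  have case0 : ∀ (N : Finset α) (a : ℕ) (φ : (α → Option G) → ℚ), 
    a ≤ N.card →
    (∀ q, pS q ⊆ N → (pS q).card = a → ∑ p ∈ low 0 q, φ p = 0) →
    ∀ p, pS p ⊆ N → (pS p).card = 0 → φ p = 0 := by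
    intro N a φ ha H p hp hp0
    obtain ⟨A, hA, hAc⟩ := exists_subset_card_eq ha
    obtain ⟨q, hq⟩ := exists_pS (G := G) A
    have := H q (hq ▸ hA) (hq ▸ hAc)
    have h0 : ∀ p : α → Option G, (pS p).card = 0 → p = fun _ => none := by
      intro p hp
      rw [card_eq_zero] at hp
      funext x
      by_contra hx
      have := (mem_pS p x).2 hx
      simp [hp] at this
    have hl : low 0 q = {p} := by
      ext p'
      rw [mem_low, mem_singleton]
      constructor
      · rintro ⟨_, h⟩; rw [h0 _ h, h0 _ hp0]
      · rintro rfl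
        refine ⟨fun x => Or.inl ?_, hp0⟩
        rw [h0 _ hp0]
    simpa [hl] using this
  have caseE : ∀ (N : Finset α) (a : ℕ) (φ : (α → Option G) → ℚ), 
    (∀ q, pS q ⊆ N → (pS q).card = a → ∑ p ∈ low a q, φ p = 0) →
    ∀ p, pS p ⊆ N → (pS p).card = a → φ p = 0 := by
    intro N a φ H p hp hpa
    have := H p hp hpa
    have hl : low a p = {p} := by
      ext p'
      rw [mem_low, mem_singleton]
      constructor
      · rintro ⟨h, h'⟩
        have he := eq_of_subset_of_card_le (ple_pS h) (by omega)
        funext x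
        rcases h x with h1 | h1
        · have : x ∉ pS p' := by simp [mem_pS, h1]
          rw [he, mem_pS, not_not] at this
          rw [h1, this]
        · exact h1
      · rintro rfl
        exact ⟨fun x => Or.inr rfl, hpa⟩
    simpa [hl] using this
  induction N using Finset.induction_on with
  | empty =>
    intro a b φ hba hab H
    simp only [card_empty] at hab
    obtain rfl : a = 0 := by omega
    obtain rfl : b = 0 := by omega
    exact caseE _ _ φ H
  | insert x N hxN ih =>
    intro a b φ hba hab H
    rcases Nat.eq_zero_or_pos b with rfl | hb
    · exact case0 _ a φ (by omega) H
    rcases Nat.eq_or_lt_of_le hba with rfl | hlt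
    · exact caseE _ _ φ H
    obtain ⟨b, rfl⟩ : ∃ b', b = b' + 1 := ⟨b - 1, by omega⟩
    obtain ⟨a, rfl⟩ : ∃ a', a = a' + 1 := ⟨a - 1, by omega⟩
    rw [card_insert_of_notMem hxN] at hab
    have hnone : ∀ q : α → Option G, pS q ⊆ N → q x = none := by
      intro q hq
      by_contra h
      exact hxN (hq ((mem_pS _ _).2 h))
    have E : ∀ g, ∀ q, pS q ⊆ N → (pS q).card = a →
        ∑ p ∈ low (b + 1) q, φ p + ∑ p ∈ low b q, φ (Function.update p x (some g)) = 0 := by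
      intro g q hq hqa
      rw [← step_add b q x (hnone q hq) g φ]
      apply H
      · rw [pS_update_some]; exact insert_subset_insert _ hq
      · rw [pS_update_some, card_insert_of_notMem (fun h => hxN (hq h)), hqa]
    have F : ∀ g, ∀ p, pS p ⊆ N → (pS p).card = b → φ (Function.update p x (some g)) = 0 := by
      intro g
      refine ih (a + 1) b (fun p => φ (Function.update p x (some g))) (by omega) (by omega) ?_
      intro q hq hqa
      have h1 := step_erase b q (fun p => φ (Function.update p x (some g)))
      have h2 := step_erase (b + 1) q φ
      rw [H q (hq.trans (subset_insert _ _)) hqa, mul_zero] at h2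
      have h3 : ∑ y ∈ pS q, (∑ p ∈ low (b + 1) (Function.update q y none), φ p +
          ∑ p ∈ low b (Function.update q y none), φ (Function.update p x (some g))) = 0 := by
        refine sum_eq_zero fun y hy => E g _ ?_ ?_
        · rw [pS_update_none]; exact (erase_subset _ _).trans hq
        · rw [pS_update_none, card_erase_of_mem hy, hqa]; rfl
      rw [sum_add_distrib, h1, h2, zero_add, hqa] at h3
      rcases mul_eq_zero.1 h3 with h | h
      · exfalso
        have : ((a + 1 : ℕ) : ℚ) = b := by linarith
        have := Nat.cast_injective this
        omega
      · exact h
    have F0 : ∀ p, pS p ⊆ N → (pS p).card = b + 1 → φ p = 0 := by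
      refine ih a (b + 1) φ (by omega) (by omega) ?_
      intro q hq hqa
      have := E (Classical.arbitrary G) q hq hqa
      rwa [sum_eq_zero (s := low b q), add_zero] at this
      intro p hp
      rw [mem_low] at hp
      exact F _ p ((ple_pS hp.1).trans hq) hp.2
    intro p hp hpb
    cases hpx : p x with
    | none =>
      refine F0 p (fun y hy => ?_) hpb
      rcases mem_insert.1 (hp hy) with rfl | h
      · exact absurd hpx ((mem_pS _ _).1 hy)
      · exact h
    | some g =>
      have := F g (Function.update p x none) ?_ ?_
      · simpa [← hpx] using this
      · rw [pS_update_none]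
        intro y hy
        rw [mem_erase] at hy
        exact mem_of_mem_insert_of_ne (hp hy.2) hy.1
      · rw [pS_update_none, card_erase_of_mem ((mem_pS _ _).2 (by simp [hpx])), hpb]; rfl

theorem card_low (b : ℕ) (q : α → Option G) : (low b q).card = (pS q).card.choose b := by
  rw [← card_powersetCard]
  refine card_nbij' pS (fun A x => if x ∈ A then q x else none) ?_ ?_ ?_ ?_
  · intro p hp
    have hp := (mem_low _ _ _).1 (mem_coe.1 hp)
    exact mem_coe.2 (mem_powersetCard.2 ⟨ple_pS hp.1, hp.2⟩)
  · intro A hA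
    have hA := mem_powersetCard.1 (mem_coe.1 hA)
    refine mem_coe.2 ((mem_low _ _ _).2 ⟨fun x => ?_, ?_⟩)
    · by_cases h : x ∈ A <;> simp [h]
    · rw [← hA.2]
      congr 1
      ext x
      by_cases h : x ∈ A
      · simpa [mem_pS, h] using (mem_pS _ _).1 (hA.1 h)
      · simp [mem_pS, h]
  · intro p hp
    have hp := (mem_low _ _ _).1 (mem_coe.1 hp)
    funext x
    rcases hp.1 x with h | h
    · simp [mem_pS, h]
    · by_cases h' : p x = none
      · simp [mem_pS, h']
      · simp [mem_pS, h', ← h]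
  · intro A hA
    have hA := mem_powersetCard.1 (mem_coe.1 hA)
    ext x
    by_cases h : x ∈ A
    · simpa [mem_pS, h] using (mem_pS _ _).1 (hA.1 h)
    · simp [mem_pS, h]

end PartialFunctions

section Tabloids
open Finset
open scoped Classical

/-- Tabloids for arbitrary size functions. -/
def Tab (G : Type) [CommGroup G] (n : ℕ) (s r : ℕ → ℕ)
    (T : (Fin n → ℕ ⊕ ℕ) × (Fin n → G)) : Prop :=
  (∀ i, Nat.card {a : Fin n // T.1 a = Sum.inl i} = s i) ∧
  (∀ j, Nat.card {a : Fin n // T.1 a = Sum.inr j} = r j) ∧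
  (∀ a j, T.1 a = Sum.inr j → T.2 a = 1)

set_option linter.unusedSectionVars false

variable {G : Type} [CommGroup G] [Fintype G] {n : ℕ}

theorem tabAct_right (w : Wr G n) (T : (Fin n → ℕ ⊕ ℕ) × (Fin n → G)) (a : Fin n) :
    (tabAct w T).1 a = T.1 (w.right⁻¹ a) := rfl

theorem tabAct_col (w : Wr G n) (T : (Fin n → ℕ ⊕ ℕ) × (Fin n → G)) (a : Fin n) :
    (tabAct w T).2 a = match T.1 (w.right⁻¹ a) with
     | Sum.inl _ => T.2 (w.right⁻¹ a) * w.left a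
     | Sum.inr _ => 1 := rfl

theorem tab_act (s r : ℕ → ℕ) (w : Wr G n) (T : (Fin n → ℕ ⊕ ℕ) × (Fin n → G))
    (h : Tab G n s r T) : Tab G n s r (tabAct w T) := by
  have key : ∀ l, Nat.card {a : Fin n // (tabAct w T).1 a = l}
      = Nat.card {a : Fin n // T.1 a = l} := by
    intro l
    exact Nat.card_congr (Equiv.subtypeEquiv (w.right⁻¹ : Equiv.Perm (Fin n)) (fun a => Iff.rfl))
  refine ⟨fun i => by rw [key, h.1], fun j => by rw [key, h.2.1], fun a j hj => ?_⟩
  rw [tabAct_right] at hj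
  rw [tabAct_col, hj]

theorem act_inv_act (w : Wr G n) (T : (Fin n → ℕ ⊕ ℕ) × (Fin n → G))
    (h : ∀ a j, T.1 a = Sum.inr j → T.2 a = 1) : tabAct w⁻¹ (tabAct w T) = T := by
  refine Prod.ext ?_ ?_
  · funext a
    simp [tabAct_right]
  · funext a
    rw [tabAct_col, tabAct_right, tabAct_col]
    have e : w.right⁻¹ ((w⁻¹).right⁻¹ a) = a := by simp
    rw [e]
    cases hT : T.1 a with
    | inl k =>
      have h2 : (w⁻¹).left a = (w.left (w.right a))⁻¹ := by
        rw [SemidirectProduct.inv_left]; rfl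
      have h3 : (w⁻¹).right⁻¹ a = w.right a := by simp
      simp only [h2, h3]
      exact mul_inv_cancel_right _ _
    | inr k => simp [h a k hT]

theorem act_act_inv (w : Wr G n) (T : (Fin n → ℕ ⊕ ℕ) × (Fin n → G))
    (h : ∀ a j, T.1 a = Sum.inr j → T.2 a = 1) : tabAct w (tabAct w⁻¹ T) = T := by
  have := act_inv_act w⁻¹ T h
  rwa [inv_inv] at this

/-- The incidence relation between tabloids of the two shapes. -/
def Le (i j : ℕ) (v t : (Fin n → ℕ ⊕ ℕ) × (Fin n → G)) : Prop :=
  ∀ x, (v.1 x = t.1 x ∧ v.2 x = t.2 x) ∨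
    (v.1 x = Sum.inr j ∧ v.2 x = 1 ∧ t.1 x = Sum.inl i)

theorem le_act (i j : ℕ) (w : Wr G n) (v t : (Fin n → ℕ ⊕ ℕ) × (Fin n → G))
    (h : Le i j v t) : Le i j (tabAct w v) (tabAct w t) := by
  intro x
  rw [tabAct_right, tabAct_right, tabAct_col, tabAct_col]
  rcases h (w.right⁻¹ x) with ⟨h1, h2⟩ | ⟨h1, h2, h3⟩
  · left; rw [h1, h2]; exact ⟨rfl, rfl⟩
  · right; rw [h1, h3]; exact ⟨rfl, rfl, rfl⟩

/-- The partial colouring given by the block `inl i`. -/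
noncomputable def tExt (i : ℕ) (T : (Fin n → ℕ ⊕ ℕ) × (Fin n → G)) : Fin n → Option G :=
  fun x => if T.1 x = Sum.inl i then some (T.2 x) else none

/-- Replace the block `inl i` by a given partial function. -/
noncomputable def tMk (i j : ℕ) (T : (Fin n → ℕ ⊕ ℕ) × (Fin n → G)) (p : Fin n → Option G) :
    (Fin n → ℕ ⊕ ℕ) × (Fin n → G) :=
  ⟨fun x => match p x with
    | some _ => Sum.inl i
    | none => if T.1 x = Sum.inl i then Sum.inr j else T.1 x,
   fun x => match p x with
    | some g => g
    | none => if T.1 x = Sum.inl i then 1 else T.2 x⟩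

theorem mk_some (i j : ℕ) (T : (Fin n → ℕ ⊕ ℕ) × (Fin n → G)) (p : Fin n → Option G) (x : Fin n)
    (g : G) (h : p x = some g) : (tMk i j T p).1 x = Sum.inl i ∧ (tMk i j T p).2 x = g := by
  simp [tMk, h]

theorem mk_none (i j : ℕ) (T : (Fin n → ℕ ⊕ ℕ) × (Fin n → G)) (p : Fin n → Option G) (x : Fin n)
    (h : p x = none) : (tMk i j T p).1 x = (if T.1 x = Sum.inl i then Sum.inr j else T.1 x) ∧
      (tMk i j T p).2 x = (if T.1 x = Sum.inl i then 1 else T.2 x) := by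
  simp [tMk, h]

theorem ext_mk (i j : ℕ) (T : (Fin n → ℕ ⊕ ℕ) × (Fin n → G)) (p : Fin n → Option G) :
    tExt i (tMk i j T p) = p := by
  funext x
  unfold tExt
  cases h : p x with
  | some g =>
    have := mk_some i j T p x g h
    simp [this.1, this.2]
  | none =>
    have := mk_none i j T p x h
    rw [this.1]
    split_ifs with h1 h2 h3 <;> simp_all

/-- Points in the blocks `inl i` and `inr j`. -/
noncomputable def NN (i j : ℕ) (T : (Fin n → ℕ ⊕ ℕ) × (Fin n → G)) : Finset (Fin n) :=
  univ.filter (fun x => T.1 x = Sum.inl i ∨ T.1 x = Sum.inr j)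

theorem mem_NN (i j : ℕ) (T : (Fin n → ℕ ⊕ ℕ) × (Fin n → G)) (x : Fin n) :
    x ∈ NN i j T ↔ T.1 x = Sum.inl i ∨ T.1 x = Sum.inr j := by simp [NN]

theorem le_NN (i j : ℕ) (v t : (Fin n → ℕ ⊕ ℕ) × (Fin n → G)) (h : Le i j v t) :
    NN i j v = NN i j t := by
  ext x
  rw [mem_NN, mem_NN]
  rcases h x with ⟨h1, h2⟩ | ⟨h1, h2, h3⟩
  · rw [h1]
  · rw [h1, h3]; simp

theorem pS_ext (i j : ℕ) (T : (Fin n → ℕ ⊕ ℕ) × (Fin n → G)) : pS (tExt i T) ⊆ NN i j T := by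
  intro x hx
  rw [mem_pS] at hx
  rw [mem_NN]
  left
  by_contra h
  simp [tExt, h] at hx

theorem card_pS_ext (i : ℕ) (T : (Fin n → ℕ ⊕ ℕ) × (Fin n → G)) :
    (pS (tExt i T)).card = Nat.card {a : Fin n // T.1 a = Sum.inl i} := by
  rw [Nat.card_eq_fintype_card, Fintype.card_subtype]
  congr 1
  ext x
  simp [mem_pS, tExt]

theorem card_NN (i j : ℕ) (T : (Fin n → ℕ ⊕ ℕ) × (Fin n → G)) :
    (NN i j T).card = Nat.card {a : Fin n // T.1 a = Sum.inl i} +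
      Nat.card {a : Fin n // T.1 a = Sum.inr j} := by
  rw [Nat.card_eq_fintype_card, Fintype.card_subtype, Nat.card_eq_fintype_card,
    Fintype.card_subtype, NN, filter_or, card_union_of_disjoint]
  rw [disjoint_filter]
  intro x _ h
  simp [h]

/-- `mk` inverts `ext` on tabloids agreeing off `NN`. -/
theorem mk_ext (i j : ℕ) (v w : (Fin n → ℕ ⊕ ℕ) × (Fin n → G))
    (hv : ∀ a j, v.1 a = Sum.inr j → v.2 a = 1) (hw : ∀ a j, w.1 a = Sum.inr j → w.2 a = 1)
    (hN : NN i j v = NN i j w)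
    (hoff : ∀ x, x ∉ NN i j v → w.1 x = v.1 x ∧ w.2 x = v.2 x) :
    tMk i j v (tExt i w) = w := by
  have key : ∀ x, (tMk i j v (tExt i w)).1 x = w.1 x ∧ (tMk i j v (tExt i w)).2 x = w.2 x := by
    intro x
    by_cases h : w.1 x = Sum.inl i
    · have := mk_some i j v (tExt i w) x (w.2 x) (by simp [tExt, h])
      exact ⟨this.1.trans h.symm, this.2⟩
    · have hm := mk_none i j v (tExt i w) x (by simp [tExt, h])
      rw [hm.1, hm.2]
      by_cases hx : x ∈ NN i j v
      · have hx' := hx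
        rw [hN, mem_NN] at hx'
        have hwj := hx'.resolve_left h
        rw [hwj, hw x j hwj]
        rw [mem_NN] at hx
        rcases hx with hx | hx
        · simp [hx]
        · simp [hx, hv x j hx]
      · have ho := hoff x hx
        rw [ho.1, ho.2]
        rw [mem_NN, not_or] at hx
        simp [hx.1]
  exact Prod.ext (funext fun x => (key x).1) (funext fun x => (key x).2)

theorem le_off (i j : ℕ) (v t : (Fin n → ℕ ⊕ ℕ) × (Fin n → G)) (h : Le i j v t) (x : Fin n)
    (hx : x ∉ NN i j v) : v.1 x = t.1 x ∧ v.2 x = t.2 x := by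
  rcases h x with h | ⟨h1, h2, h3⟩
  · exact h
  · exact absurd ((mem_NN _ _ _ _).2 (Or.inr h1)) hx

theorem mk_off (i j : ℕ) (v : (Fin n → ℕ ⊕ ℕ) × (Fin n → G)) (p : Fin n → Option G)
    (hp : pS p ⊆ NN i j v) (x : Fin n)
    (hx : x ∉ NN i j v) : (tMk i j v p).1 x = v.1 x ∧ (tMk i j v p).2 x = v.2 x := by
  have : p x = none := by
    by_contra h
    exact hx (hp ((mem_pS _ _).2 h))
  have hm := mk_none i j v p x this
  rw [mem_NN, not_or] at hx
  simpa [hx.1] using hm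

theorem NN_mk (i j : ℕ) (v : (Fin n → ℕ ⊕ ℕ) × (Fin n → G)) (p : Fin n → Option G)
    (hp : pS p ⊆ NN i j v) : NN i j (tMk i j v p) = NN i j v := by
  ext x
  rw [mem_NN, mem_NN]
  cases h : p x with
  | some g =>
    have := hp ((mem_pS p x).2 (by simp [h]))
    rw [mem_NN] at this
    simp [(mk_some i j v p x g h).1, this]
  | none =>
    rw [(mk_none i j v p x h).1]
    split_ifs with h1
    · simp [h1]
    · rfl

theorem mk_norm (i j : ℕ) (v : (Fin n → ℕ ⊕ ℕ) × (Fin n → G))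
    (hv : ∀ a j, v.1 a = Sum.inr j → v.2 a = 1) (p : Fin n → Option G) :
    ∀ a k, (tMk i j v p).1 a = Sum.inr k → (tMk i j v p).2 a = 1 := by
  intro x k hk
  cases h : p x with
  | some g => simp [(mk_some i j v p x g h).1] at hk
  | none =>
    have hm := mk_none i j v p x h
    rw [hm.1] at hk
    rw [hm.2]
    split_ifs at hk ⊢ with h1
    · rfl
    · exact hv x k hk

theorem tab_mk (s r : ℕ → ℕ) (i j k l k' l' : ℕ) (v : (Fin n → ℕ ⊕ ℕ) × (Fin n → G))
    (hv : Tab G n (Function.update s i k) (Function.update r j l) v)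
    (p : Fin n → Option G) (hp : pS p ⊆ NN i j v) (hc : (pS p).card = k') (hk : k' + l' = k + l) :
    Tab G n (Function.update s i k') (Function.update r j l') (tMk i j v p) := by
  have h1 : Nat.card {a : Fin n // (tMk i j v p).1 a = Sum.inl i} = k' := by
    rw [← card_pS_ext, ext_mk, hc]
  have h2 : Nat.card {a : Fin n // (tMk i j v p).1 a = Sum.inr j} = l' := by
    have e1 := card_NN i j (tMk i j v p)
    have e2 := card_NN i j v
    rw [hv.1, hv.2.1] at e2
    rw [NN_mk i j v p hp, e2, h1] at e1
    rw [Function.update_self, Function.update_self] at e1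
    omega
  have h3 : ∀ lab : ℕ ⊕ ℕ, lab ≠ Sum.inl i → lab ≠ Sum.inr j →
      ∀ x, (tMk i j v p).1 x = lab ↔ v.1 x = lab := by
    intro lab l1 l2 x
    by_cases hx : x ∈ NN i j v
    · have hx' := hx
      rw [← NN_mk i j v p hp, mem_NN] at hx'
      rw [mem_NN] at hx
      constructor
      · rintro rfl; exact absurd hx' (by simp [l1, l2])
      · rintro rfl; exact absurd hx (by simp [l1, l2])
    · rw [(mk_off i j v p hp x hx).1]
  refine ⟨fun m => ?_, fun m => ?_, mk_norm i j v hv.2.2 p⟩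
  · by_cases hm : m = i
    · subst hm; simpa using h1
    · rw [Nat.card_congr (Equiv.subtypeEquivRight (h3 (Sum.inl m) (by simpa using hm) (by simp))),
        hv.1, Function.update_of_ne hm, Function.update_of_ne hm]
  · by_cases hm : m = j
    · subst hm; simpa using h2
    · rw [Nat.card_congr (Equiv.subtypeEquivRight (h3 (Sum.inr m) (by simp) (by simpa using hm))),
        hv.2.1, Function.update_of_ne hm, Function.update_of_ne hm]

theorem le_iff (i j : ℕ) (v : (Fin n → ℕ ⊕ ℕ) × (Fin n → G))
    (hv : ∀ a j, v.1 a = Sum.inr j → v.2 a = 1) (p q : Fin n → Option G)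
    (hp : pS p ⊆ NN i j v) (hq : pS q ⊆ NN i j v) :
    Le i j (tMk i j v p) (tMk i j v q) ↔ ple p q := by
  constructor
  · intro h x
    cases hpx : p x with
    | none => exact Or.inl rfl
    | some g =>
      right
      have h1 := mk_some i j v p x g hpx
      rcases h x with h2 | h2
      · rw [h1.1, h1.2] at h2
        have h3 := congrFun (ext_mk i j v q) x
        rw [← h3, tExt, if_pos h2.1.symm, ← h2.2]
      · rw [h1.1] at h2; simp at h2
  · intro h x
    rcases h x with h1 | h1
    · cases hqx : q x with
      | none =>
        left
        rw [(mk_none i j v p x h1).1, (mk_none i j v p x h1).2,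
          (mk_none i j v q x hqx).1, (mk_none i j v q x hqx).2]
        exact ⟨rfl, rfl⟩
      | some g =>
        right
        have hx := (mem_NN _ _ _ _).1 (hq ((mem_pS q x).2 (by simp [hqx])))
        rw [(mk_none i j v p x h1).1, (mk_none i j v p x h1).2, (mk_some i j v q x g hqx).1]
        rcases hx with hx | hx
        · simp [hx]
        · simp [hx, hv x j hx]
    · left
      simp [tMk, h1]

noncomputable instance wrFintype : Fintype (Wr G n) :=
  Fintype.ofEquiv _ SemidirectProduct.equivProd.symm

/-- Number of elements of `Y` satisfying `P`. -/
noncomputable def cnt (Y : Set (Wr G n)) (P : Wr G n → Prop) : ℕ :=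
  (univ.filter (fun y => y ∈ Y ∧ P y)).card

theorem card_cnt (Y : Set (Wr G n)) (P : Wr G n → Prop) :
    Nat.card {y : Wr G n // y ∈ Y ∧ P y} = cnt Y P := by
  rw [Nat.card_eq_fintype_card, Fintype.card_subtype, cnt]

theorem cnt_fiber {β : Type} (Y : Set (Wr G n)) (P : Wr G n → Prop) (f : Wr G n → β)
    (F : Finset β) (Q : β → Wr G n → Prop) (h1 : ∀ y, P y → f y ∈ F)
    (h2 : ∀ z ∈ F, ∀ y, Q z y ↔ P y ∧ f y = z) :
    cnt Y P = ∑ z ∈ F, cnt Y (Q z) := by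
  unfold cnt
  rw [card_eq_sum_card_fiberwise (f := f) (t := F)]
  · refine sum_congr rfl fun z hz => ?_
    congr 1
    ext y
    simp only [mem_filter, mem_univ, true_and, h2 z hz]
    tauto
  · intro y hy
    simp only [coe_filter, mem_univ, true_and, Set.mem_ofPred_eq] at hy
    exact h1 y hy.2

theorem core (s r : ℕ → ℕ) (i j a b : ℕ) (hba : b ≤ a) (Y : Set (Wr G n))
    (hY : IsTransitiveOn tabAct
      {T | Tab G n (Function.update s i a) (Function.update r j b) T} Y) :
    IsTransitiveOn tabAct
      {T | Tab G n (Function.update s i b) (Function.update r j a) T} Y := by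
  obtain ⟨c, hc, hY⟩ := hY
  set Ω1 := {T | Tab G n (Function.update s i a) (Function.update r j b) T} with hΩ1
  set Ω2 := {T | Tab G n (Function.update s i b) (Function.update r j a) T} with hΩ2
  simp only [card_cnt] at hY
  unfold IsTransitiveOn
  simp only [card_cnt]
  have hN2 : ∀ v ∈ Ω2, (NN i j v).card = a + b := by
    intro v hv
    rw [card_NN, hv.1, hv.2.1]; simp [add_comm]
  have hr2 : ∀ v ∈ Ω2, (pS (tExt i v)).card = b := by
    intro v hv
    rw [card_pS_ext, hv.1]; simp
  have hr1 : ∀ v ∈ Ω1, (pS (tExt i v)).card = a := by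
    intro v hv
    rw [card_pS_ext, hv.1]; simp
  -- the number of upper neighbours
  let Q : (Fin n → ℕ ⊕ ℕ) × (Fin n → G) → Finset (Fin n → Option G) := fun u =>
    univ.filter (fun q => pS q ⊆ NN i j u ∧ (pS q).card = a ∧ ple (tExt i u) q)
  have mk_self : ∀ u ∈ Ω2, tMk i j u (tExt i u) = u := by
    intro u hu
    exact mk_ext i j u u hu.2.2 hu.2.2 rfl (fun _ _ => ⟨rfl, rfl⟩)
  have up : ∀ u ∈ Ω2, ∀ t ∈ Ω1, cnt Y (fun y => Le i j (tabAct y u) t) = (Q u).card * c := by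
    intro u hu t ht
    have key : ∀ y, Le i j (tabAct y u) t →
        Le i j u (tabAct y⁻¹ t) ∧ tMk i j u (tExt i (tabAct y⁻¹ t)) = tabAct y⁻¹ t := by
      intro y hy
      have h1 := le_act i j y⁻¹ _ _ hy
      rw [act_inv_act y u hu.2.2] at h1
      refine ⟨h1, mk_ext i j u _ hu.2.2 (tab_act _ _ _ _ ht).2.2 (le_NN _ _ _ _ h1) ?_⟩
      intro x hx
      have := le_off i j _ _ h1 x hx
      exact ⟨this.1.symm, this.2.symm⟩
    rw [cnt_fiber Y _ (fun y => tExt i (tabAct y⁻¹ t)) (Q u)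
      (fun q y => tabAct y (tMk i j u q) = t)]
    · rw [sum_congr rfl (g := fun _ => c), sum_const, smul_eq_mul]
      intro q hq
      simp only [Q, mem_filter, mem_univ, true_and] at hq
      exact hY _ (tab_mk s r i j b a a b u hu q hq.1 hq.2.1 (by omega)) _ ht
    · intro y hy
      obtain ⟨h1, h2⟩ := key y hy
      have hsub : pS (tExt i (tabAct y⁻¹ t)) ⊆ NN i j u := by
        rw [le_NN _ _ _ _ h1]; exact pS_ext _ _ _
      simp only [Q, mem_filter, mem_univ, true_and]
      refine ⟨hsub, hr1 _ (tab_act _ _ _ _ ht), ?_⟩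
      rw [← le_iff i j u hu.2.2 _ _ (pS_ext _ _ _) hsub, h2, mk_self u hu]
      exact h1
    · intro q hq y
      simp only [Q, mem_filter, mem_univ, true_and] at hq
      constructor
      · rintro rfl
        constructor
        · apply le_act
          have := (le_iff i j u hu.2.2 _ _ (pS_ext _ _ _) hq.1).2 hq.2.2
          rwa [mk_self u hu] at this
        · rw [act_inv_act, ext_mk]
          exact mk_norm _ _ _ hu.2.2 _
      · rintro ⟨h1, h2⟩
        have h3 := (key y h1).2
        rw [← h2, h3, act_act_inv _ _ ht.2.2]
  have down : ∀ u ∈ Ω2, ∀ v ∈ Ω2, ∀ q, pS q ⊆ NN i j v → (pS q).card = a →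
      cnt Y (fun y => Le i j (tabAct y u) (tMk i j v q)) =
        ∑ p ∈ low b q, cnt Y (fun y => tabAct y u = tMk i j v p) := by
    intro u hu v hv q hq hqa
    have key : ∀ y, Le i j (tabAct y u) (tMk i j v q) →
        NN i j (tabAct y u) = NN i j v ∧ tMk i j v (tExt i (tabAct y u)) = tabAct y u := by
      intro y hy
      have h1 : NN i j (tabAct y u) = NN i j v := by rw [le_NN _ _ _ _ hy, NN_mk _ _ _ _ hq]
      refine ⟨h1, mk_ext i j v _ hv.2.2 (tab_act _ _ _ _ hu).2.2 h1.symm ?_⟩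
      intro x hx
      have e1 := le_off i j _ _ hy x (by rwa [h1])
      have e2 := mk_off i j v q hq x hx
      exact ⟨e1.1.trans e2.1, e1.2.trans e2.2⟩
    refine cnt_fiber Y _ (fun y => tExt i (tabAct y u)) _ _ ?_ ?_
    · intro y hy
      obtain ⟨h1, h2⟩ := key y hy
      rw [mem_low]
      refine ⟨?_, hr2 _ (tab_act _ _ _ _ hu)⟩
      rw [← le_iff i j v hv.2.2 _ _ (h1 ▸ pS_ext _ _ _) hq, h2]
      exact hy
    · intro p hp y
      rw [mem_low] at hp
      constructor
      · intro h
        rw [h, ext_mk]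
        exact ⟨(le_iff i j v hv.2.2 _ _ ((ple_pS hp.1).trans hq) hq).2 hp.1, rfl⟩
      · rintro ⟨h1, h2⟩
        rw [← h2, (key y h1).2]
  have hch : (0 : ℚ) < (a.choose b : ℚ) := by exact_mod_cast Nat.choose_pos hba
  have main : ∀ u ∈ Ω2, ∀ v ∈ Ω2,
      (cnt Y (fun y => tabAct y u = v) : ℚ) = ((Q u).card * c : ℕ) / (a.choose b : ℚ) := by
    intro u hu v hv
    have := low_inj (NN i j v) a b
      (fun p => (cnt Y (fun y => tabAct y u = tMk i j v p) : ℚ)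
        - ((Q u).card * c : ℕ) / (a.choose b : ℚ)) hba (hN2 v hv).ge ?_
      (tExt i v) (pS_ext _ _ _) (hr2 v hv)
    · simp only [mk_self v hv] at this
      linarith
    · intro q hq hqa
      have h1 := down u hu v hv q hq hqa
      rw [up u hu _ (tab_mk s r i j b a a b v hv q hq hqa (by omega))] at h1
      rw [sum_sub_distrib, ← Nat.cast_sum, ← h1, sum_const, card_low, hqa, nsmul_eq_mul]
      field_simp
      simp
  have hQ : ∀ u ∈ Ω2, 0 < (Q u).card := by
    intro u hu
    obtain ⟨A, hA1, hA2, hA3⟩ := exists_subsuperset_card_eq (pS_ext i j u)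
      (n := a) (by rw [hr2 u hu]; exact hba) (by rw [hN2 u hu]; omega)
    rw [card_pos]
    refine ⟨fun x => if x ∈ A then (if u.1 x = Sum.inl i then some (u.2 x) else some 1) else none,
      ?_⟩
    have hS : pS (fun x => if x ∈ A then
        (if u.1 x = Sum.inl i then some (u.2 x) else some 1) else none) = A := by
      ext x
      rw [mem_pS]
      by_cases h : x ∈ A
      · by_cases h' : u.1 x = Sum.inl i <;> simp [h, h']
      · simp [h]
    simp only [Q, mem_filter, mem_univ, true_and]
    rw [hS]
    refine ⟨hA2, hA3, fun x => ?_⟩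
    by_cases h : u.1 x = Sum.inl i
    · right
      have : x ∈ A := hA1 ((mem_pS _ _).2 (by simp [tExt, h]))
      simp [tExt, h, this]
    · left; simp [tExt, h]
  have pos : ∀ u ∈ Ω2, ∀ v ∈ Ω2, 0 < cnt Y (fun y => tabAct y u = v) := by
    intro u hu v hv
    have h1 := main u hu v hv
    have h2 : (0 : ℚ) < ((Q u).card * c : ℕ) := by
      exact_mod_cast Nat.mul_pos (hQ u hu) hc
    have : (0 : ℚ) < (cnt Y (fun y => tabAct y u = v) : ℚ) := by rw [h1]; positivity
    exact_mod_cast this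
  have row : ∀ u ∈ Ω2, ∀ v ∈ Ω2, ∀ v' ∈ Ω2,
      cnt Y (fun y => tabAct y u = v) = cnt Y (fun y => tabAct y u = v') := by
    intro u hu v hv v' hv'
    have := (main u hu v hv).trans (main u hu v' hv').symm
    exact_mod_cast this
  rcases Set.eq_empty_or_nonempty Ω2 with he | ⟨u0, hu0⟩
  · exact ⟨1, one_pos, fun u hu => by rw [he] at hu; exact absurd hu (Set.notMem_empty _)⟩
  refine ⟨cnt Y (fun y => tabAct y u0 = u0), pos _ hu0 _ hu0, fun u hu v hv => ?_⟩
  rw [row u hu v hv u0 hu0]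
  -- compare the two rows by double counting over a common finite set of targets
  let F : Finset ((Fin n → ℕ ⊕ ℕ) × (Fin n → G)) :=
    (univ.image fun y : Wr G n => tabAct y u) ∪ (univ.image fun y : Wr G n => tabAct y u0)
  have hF : ∀ z ∈ F, z ∈ Ω2 := by
    intro z hz
    simp only [F, mem_union, mem_image, mem_univ, true_and] at hz
    rcases hz with ⟨y, rfl⟩ | ⟨y, rfl⟩
    · exact tab_act _ _ _ _ hu
    · exact tab_act _ _ _ _ hu0
  have tot : ∀ w ∈ Ω2, (∀ y : Wr G n, tabAct y w ∈ F) →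
      cnt Y (fun _ => True) = F.card * cnt Y (fun y => tabAct y w = u0) := by
    intro w hw hwF
    rw [cnt_fiber Y _ (fun y => tabAct y w) F (fun z y => tabAct y w = z) (fun y _ => hwF y)
      (fun z _ y => by simp)]
    rw [sum_congr rfl (fun z hz => row w hw z (hF z hz) u0 hu0), sum_const, smul_eq_mul]
  have t1 := tot u hu (fun y => by simp [F])
  have t2 := tot u0 hu0 (fun y => by simp [F])
  have hFpos : 0 < F.card := card_pos.2 ⟨tabAct 1 u, by simp [F]⟩
  exact Nat.eq_of_mul_eq_mul_left hFpos (t1.symm.trans t2)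

theorem relabel (s r s' r' : ℕ → ℕ) (e f : Equiv.Perm ℕ) (hs : ∀ k, s k = s' (e k))
    (hr : ∀ k, r k = r' (f k)) (Y : Set (Wr G n))
    (hY : IsTransitiveOn tabAct {T | Tab G n s r T} Y) :
    IsTransitiveOn tabAct {T | Tab G n s' r' T} Y := by
  obtain ⟨c, hc, hY⟩ := hY
  refine ⟨c, hc, fun u hu v hv => ?_⟩
  let E : ℕ ⊕ ℕ ≃ ℕ ⊕ ℕ := Equiv.sumCongr e.symm f.symm
  let R : (Fin n → ℕ ⊕ ℕ) × (Fin n → G) → (Fin n → ℕ ⊕ ℕ) × (Fin n → G) :=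
    fun T => (fun a => E (T.1 a), T.2)
  have hR : ∀ T, Tab G n s' r' T → Tab G n s r (R T) := by
    intro T hT
    refine ⟨fun k => ?_, fun k => ?_, fun a k h => ?_⟩
    · rw [hs, ← hT.1]
      refine Nat.card_congr (Equiv.subtypeEquivRight fun a => ?_)
      show E (T.1 a) = _ ↔ _
      rw [← Equiv.eq_symm_apply]; rfl
    · rw [hr, ← hT.2.1]
      refine Nat.card_congr (Equiv.subtypeEquivRight fun a => ?_)
      show E (T.1 a) = _ ↔ _
      rw [← Equiv.eq_symm_apply]; rfl
    · have h : E (T.1 a) = Sum.inr k := h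
      rw [← Equiv.eq_symm_apply] at h
      exact hT.2.2 a _ h
  have hinj : Function.Injective R := by
    intro T T' h
    have h1 : (fun a => E (T.1 a)) = (fun a => E (T'.1 a)) := congrArg Prod.fst h
    have h2 : T.2 = T'.2 := congrArg (fun z => z.2) h
    exact Prod.ext (funext fun a => E.injective (congrFun h1 a)) h2
  have hcomm : ∀ y T, tabAct y (R T) = R (tabAct y T) := by
    intro y T
    refine Prod.ext rfl (funext fun a => ?_)
    show (tabAct y (R T)).2 a = (tabAct y T).2 a
    rw [tabAct_col, tabAct_col]
    show (match E (T.1 (y.right⁻¹ a)) with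
     | Sum.inl _ => T.2 (y.right⁻¹ a) * y.left a
     | Sum.inr _ => 1) = _
    cases T.1 (y.right⁻¹ a) <;> rfl
  rw [← hY _ (hR u hu) _ (hR v hv)]
  refine Nat.card_congr (Equiv.subtypeEquivRight fun y => ?_)
  rw [hcomm, hinj.eq_iff]

theorem getD_perm {l l' : List ℕ} (h : l.Perm l') :
    ∃ e : Equiv.Perm ℕ, ∀ k, l.getD k 0 = l'.getD (e k) 0 := by
  induction h with
  | nil => exact ⟨1, fun k => rfl⟩
  | @cons x l l' _ ih =>
    obtain ⟨e, he⟩ := ih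
    let N : ℕ ≃ Option ℕ := ⟨fun k => Nat.casesOn k none some, fun o => o.elim 0 Nat.succ,
      fun k => by cases k <;> rfl, fun o => by cases o <;> rfl⟩
    refine ⟨(N.trans (Equiv.optionCongr e)).trans N.symm, fun k => ?_⟩
    cases k with
    | zero => rfl
    | succ k =>
      have : ((N.trans (Equiv.optionCongr e)).trans N.symm) (k + 1) = e k + 1 := rfl
      rw [this, List.getD_cons_succ, List.getD_cons_succ, he]
  | swap x y l =>
    refine ⟨Equiv.swap 0 1, fun k => ?_⟩
    match k with
    | 0 => simp
    | 1 => simp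
    | k + 2 => rw [Equiv.swap_apply_of_ne_of_ne (by omega) (by omega)]; rfl
  | trans _ _ ih1 ih2 =>
    obtain ⟨e, he⟩ := ih1
    obtain ⟨f, hf⟩ := ih2
    exact ⟨e.trans f, fun k => by rw [he, hf]; rfl⟩

theorem dparts_list (s : Multiset ℕ) (l : List ℕ) (h : (l : Multiset ℕ) = s) :
    ∃ e : Equiv.Perm ℕ, ∀ k, dparts s k = l.getD (e k) 0 := by
  apply getD_perm
  refine (List.reverse_perm _).trans ?_
  rw [← Multiset.coe_eq_coe, Multiset.sort_eq, h]

theorem dparts_update (s : Multiset ℕ) (k b : ℕ) :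
    ∃ e : Equiv.Perm ℕ, ∀ x, Function.update (dparts s) k b x
      = dparts (s.erase (dparts s k) + {b}) (e x) := by
  set a := dparts s k with ha
  set M := (s.erase a).toList with hM
  have hMs : (M : Multiset ℕ) = s.erase a := Multiset.coe_toList _
  have h1 : ∃ e : Equiv.Perm ℕ, ∀ x, dparts s x = (a :: M).getD (e x) 0 := by
    by_cases has : a ∈ s
    · apply dparts_list
      rw [← Multiset.cons_coe, hMs, Multiset.cons_erase has]
    · have ha0 : a = 0 := by
        by_contra h
        apply has
        rw [ha, dparts] at h ⊢
        by_cases hk : k < ((s.sort (· ≤ ·)).reverse).length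
        · rw [List.getD_eq_getElem _ _ hk]
          have := List.getElem_mem hk
          rwa [List.mem_reverse, Multiset.mem_sort] at this
        · rw [List.getD_eq_default _ _ (by omega)] at h
          exact absurd rfl h
      rw [Multiset.erase_of_notMem has] at hMs
      obtain ⟨e, he⟩ := dparts_list s M hMs
      obtain ⟨f, hf⟩ := getD_perm (List.perm_append_singleton a M)
      refine ⟨e.trans f, fun x => ?_⟩
      rw [he]
      show _ = (a :: M).getD (f (e x)) 0
      rw [← hf, ha0]
      by_cases hx : e x < M.length
      · rw [List.getD_append _ _ _ _ hx]
      · rw [List.getD_append_right _ _ _ _ (by omega), List.getD_eq_default _ _ (by omega)]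
        cases (e x - M.length) <;> simp
  obtain ⟨e, he⟩ := h1
  -- normalise so that `k` goes to `0`
  have h2 : ∃ e : Equiv.Perm ℕ, e k = 0 ∧ ∀ x, dparts s x = (a :: M).getD (e x) 0 := by
    refine ⟨e.trans (Equiv.swap 0 (e k)), by simp, fun x => ?_⟩
    rw [Equiv.trans_apply]
    by_cases hx : x = k
    · subst hx; simp [← ha]
    · by_cases hx0 : e x = 0
      · rw [hx0, Equiv.swap_apply_left, ← he k, he x, hx0]; rfl
      · rw [Equiv.swap_apply_of_ne_of_ne hx0 (fun h => hx (e.injective h)), he]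
  obtain ⟨e, hek, he⟩ := h2
  obtain ⟨f, hf⟩ := dparts_list (s.erase a + {b}) (b :: M) (by
    rw [← Multiset.cons_coe, hMs, add_comm]; rfl)
  refine ⟨e.trans f.symm, fun x => ?_⟩
  rw [hf, Equiv.trans_apply, Equiv.apply_symm_apply]
  by_cases hx : x = k
  · subst hx; simp [hek]
  · rw [Function.update_of_ne hx, he]
    have : e x ≠ 0 := fun h => hx (e.injective (h.trans hek.symm))
    obtain ⟨m, hm⟩ := Nat.exists_eq_succ_of_ne_zero this
    rw [hm]; rfl

end Tabloids

/-- **Exchange rule.**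
Let `G` be a nontrivial finite abelian group, `(σ,ρ)` a double partition of `n`, and
`i`, `j` positive integers with `σ_i > ρ_j`.  Let `(σ̃, ρ̃)` be obtained from `(σ,ρ)`
by exchanging the part `σ_i` of `σ` with the part `ρ_j` of `ρ` (reordering decreasingly;
as multisets of parts: remove one copy of `σ_i` from `σ` and add `ρ_j`, and vice versa).
Then `(σ,ρ) ≽_G (σ̃,ρ̃)`. -/
theorem exchange_rule (G : Type) [CommGroup G] [Fintype G] [Nontrivial G]
    (n : ℕ) (hn : 1 ≤ n) (σ ρ : Multiset ℕ) (hσ0 : 0 ∉ σ) (hρ0 : 0 ∉ ρ)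
    (hsum : σ.sum + ρ.sum = n)
    (i j : ℕ) (hi : 1 ≤ i) (hj : 1 ≤ j)
    (hgt : dparts ρ (j - 1) < dparts σ (i - 1)) :
    DPDom G n σ ρ
      (σ.erase (dparts σ (i - 1)) + {dparts ρ (j - 1)})
      (ρ.erase (dparts ρ (j - 1)) + {dparts σ (i - 1)}) := by
  intro Y hY
  have h0 : IsTransitiveOn tabAct {T | Tab G n
      (Function.update (dparts σ) (i - 1) (dparts σ (i - 1)))
      (Function.update (dparts ρ) (j - 1) (dparts ρ (j - 1))) T} Y := by
    rw [Function.update_eq_self, Function.update_eq_self]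
    exact hY
  have h1 := core (dparts σ) (dparts ρ) (i - 1) (j - 1) _ _ hgt.le Y h0
  obtain ⟨e, he⟩ := dparts_update σ (i - 1) (dparts ρ (j - 1))
  obtain ⟨f, hf⟩ := dparts_update ρ (j - 1) (dparts σ (i - 1))
  exact relabel _ _ _ _ e f he hf Y h1
end
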